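/- (One-particle Morawetz identity for the cubic GP hierarchy.) Let (γ^{(k)})_{k≥1} be a solution of the cubic Gross–Pitaevskii hierarchy on ℝᵈ as in the setup, let a : ℝᵈ → ℝ be smooth with all derivatives of at most polynomial growth, and define the Morawetz action M_a(t) = ∫_{ℝᵈ} ∇a(x) · P(t,x) dx, where P(t,x) = (1/(2i)) (∇_x − ∇_{x'}) γ^{(1)}(t,x;x') |_{x'=x}. Then for every t, d/dt M_a(t) = −(1/2) ∫_{ℝᵈ} (ΔΔa(x)) γ^{(1)}(t,x;x) dx + (λ/2) ∫_{ℝᵈ} (Δa(x)) γ^{(2)}(t,x,x;x,x) dx + 2 Re ∫_{ℝᵈ} Σ_{j,ℓ} (∂_{x_j}∂_{x_ℓ} a(x)) [ ∂_{x_ℓ} ∂_{x'_j} γ^{(1)}(t,x;x') ] |_{x'=x} dx. -/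

import Mathlib

open MeasureTheory Complex

noncomputable section

/-- Euclidean space `ℝᵈ`. -/
abbrev Ed (d : ℕ) := EuclideanSpace ℝ (Fin d)

/-- Laplacian `Δ_{x_j}` acting in the `j`-th particle variable of a function of
`k` particle variables. -/
noncomputable def lapAt {d k : ℕ} (j : Fin k) (f : (Fin k → Ed d) → ℂ)
    (x : Fin k → Ed d) : ℂ :=
  ∑ ℓ : Fin d,
    fderiv ℝ (fun z => fderiv ℝ f z (Pi.single j (EuclideanSpace.single ℓ 1))) x
      (Pi.single j (EuclideanSpace.single ℓ 1))

/-- The collision operator `B_{k+1}` of the cubic GP hierarchy: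
`(B_{k+1}γ^{(k+1)})(x⃗;x⃗') = Σ_j [γ^{(k+1)}(x⃗,x_j;x⃗',x_j) − γ^{(k+1)}(x⃗,x'_j;x⃗',x'_j)]`. -/
noncomputable def Bcoll {d k : ℕ}
    (g : (Fin (k + 1) → Ed d) → (Fin (k + 1) → Ed d) → ℂ)
    (x x' : Fin k → Ed d) : ℂ :=
  ∑ j : Fin k,
    (g (Fin.snoc x (x j)) (Fin.snoc x' (x j))
      - g (Fin.snoc x (x' j)) (Fin.snoc x' (x' j)))

/-- A Schwartz-class solution of the cubic Gross–Pitaevskii hierarchy on `ℝᵈ` with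
coupling `λ`: smooth, Schwartz in the space variables locally uniformly in `t`,
hermitean, symmetric, admissible, and solving
`i∂ₜγ^{(k)} = −Σ_j (Δ_{x_j} − Δ_{x'_j})γ^{(k)} + λ B_{k+1}γ^{(k+1)}`. -/
structure GPSolution (d : ℕ) (lam : ℝ)
    (γ : (k : ℕ) → ℝ → (Fin k → Ed d) → (Fin k → Ed d) → ℂ) : Prop where
  smooth : ∀ k, ContDiff ℝ (⊤ : ℕ∞)
      (fun q : ℝ × (Fin k → Ed d) × (Fin k → Ed d) => γ k q.1 q.2.1 q.2.2)
  decay : ∀ (k m N : ℕ) (T : ℝ), ∃ C : ℝ, ∀ t : ℝ, |t| ≤ T →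
      ∀ q : (Fin k → Ed d) × (Fin k → Ed d),
        (1 + ‖q‖) ^ N *
            ‖iteratedFDeriv ℝ m
              (fun r : (Fin k → Ed d) × (Fin k → Ed d) => γ k t r.1 r.2) q‖ ≤ C
  hermitian : ∀ k t x x', γ k t x x' = starRingEnd ℂ (γ k t x' x)
  symm : ∀ k t (σ : Equiv.Perm (Fin k)) x x', γ k t (x ∘ σ) (x' ∘ σ) = γ k t x x'
  admissible : ∀ k t x x',
      γ k t x x' = ∫ y : Ed d, γ (k + 1) t (Fin.snoc x y) (Fin.snoc x' y)
  eq : ∀ k t x x',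
      Complex.I * deriv (fun s => γ k s x x') t
        = -(∑ j : Fin k, (lapAt j (fun z => γ k t z x') x - lapAt j (γ k t x) x'))
          + lam * Bcoll (γ (k + 1) t) x x'

/-- The one-particle configuration `(x)` as an element of `Fin 1 → ℝᵈ`. -/
def onePt {d : ℕ} (x : Ed d) : Fin 1 → Ed d := fun _ => x

/-- The momentum density
`P_ℓ(x) = (1/(2i))(∂_{x_ℓ} − ∂_{x'_ℓ})γ^{(1)}(x;x')|_{x'=x}` associated with a
one-particle kernel `γ¹`. -/
noncomputable def Pmom {d : ℕ}
    (γ1 : (Fin 1 → Ed d) → (Fin 1 → Ed d) → ℂ) (ℓ : Fin d) (x : Ed d) : ℂ :=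
  (1 / (2 * Complex.I)) *
    (fderiv ℝ (fun z => γ1 (onePt z) (onePt x)) x (EuclideanSpace.single ℓ 1)
      - fderiv ℝ (fun z => γ1 (onePt x) (onePt z)) x (EuclideanSpace.single ℓ 1))

/-- Partial derivative `∂_{x_j} f` of a real-valued function on `ℝᵈ`. -/
noncomputable def rpdE {d : ℕ} (j : Fin d) (f : Ed d → ℝ) (x : Ed d) : ℝ :=
  fderiv ℝ f x (EuclideanSpace.single j 1)

/-- Laplacian of a real-valued function on `ℝᵈ`. -/
noncomputable def rlapE {d : ℕ} (f : Ed d → ℝ) (x : Ed d) : ℝ := ∑ j, rpdE j (rpdE j f) x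

open scoped ContDiff

/-- Directional derivative operator. -/
def Dv {V W : Type*} [NormedAddCommGroup V] [NormedSpace ℝ V] [NormedAddCommGroup W]
    [NormedSpace ℝ W] (v : V) (f : V → W) : V → W := fun x => fderiv ℝ f x v

section gen
set_option linter.unusedSectionVars false
variable {V U W : Type*} [NormedAddCommGroup V] [NormedSpace ℝ V] [NormedAddCommGroup U]
    [NormedSpace ℝ U] [NormedAddCommGroup W] [NormedSpace ℝ W]

theorem Dv_smooth {f : V → W} (hf : ContDiff ℝ ∞ f) (v : V) : ContDiff ℝ ∞ (Dv v f) := by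
  have : ContDiff ℝ ∞ (fderiv ℝ f) := hf.fderiv_right (by simp)
  exact this.clm_apply contDiff_const

theorem smooth_diff {f : V → W} (hf : ContDiff ℝ ∞ f) : Differentiable ℝ f :=
  hf.differentiable (by simp)

theorem Dv_comm {f : V → W} (hf : ContDiff ℝ ∞ f) (v w : V) : Dv v (Dv w f) = Dv w (Dv v f) := by
  have h1 : Differentiable ℝ (fderiv ℝ f) := by
    have : ContDiff ℝ ∞ (fderiv ℝ f) := hf.fderiv_right (by simp)
    exact smooth_diff this
  funext x
  have hs : IsSymmSndFDerivAt ℝ f x := hf.contDiffAt.isSymmSndFDerivAt (by simp; exact WithTop.coe_le_coe.2 le_top)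
  have key : ∀ a b : V, Dv a (Dv b f) x = fderiv ℝ (fderiv ℝ f) x a b := by
    intro a b
    change fderiv ℝ (fun y => fderiv ℝ f y b) x a = _
    rw [fderiv_clm_apply (h1 x) (by fun_prop)]
    simp
  rw [key, key, hs.eq]

theorem Dv_comp {f : V → W} (hf : ContDiff ℝ ∞ f) (L : U →L[ℝ] V) (u : U) :
    Dv u (f ∘ L) = (Dv (L u) f) ∘ L := by
  funext x
  simp only [Dv, Function.comp]
  have := ((smooth_diff hf (L x)).hasFDerivAt.comp x L.hasFDerivAt).fderiv
  rw [this]; rfl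

theorem Dv_add_dir (f : V → W) (v w : V) : Dv (v + w) f = Dv v f + Dv w f := by
  funext x; simp [Dv]
theorem Dv_sub_dir (f : V → W) (v w : V) : Dv (v - w) f = Dv v f - Dv w f := by
  funext x; simp [Dv]

theorem Dv_add {f g : V → W} (hf : ContDiff ℝ ∞ f) (hg : ContDiff ℝ ∞ g) (v : V) :
    Dv v (f + g) = Dv v f + Dv v g := by
  funext x
  simp [Dv, fderiv_add (smooth_diff hf x) (smooth_diff hg x)]
theorem Dv_sub {f g : V → W} (hf : ContDiff ℝ ∞ f) (hg : ContDiff ℝ ∞ g) (v : V) :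
    Dv v (f - g) = Dv v f - Dv v g := by
  funext x
  simp [Dv, fderiv_sub (smooth_diff hf x) (smooth_diff hg x)]
theorem sm_add {f g : V → W} (hf : ContDiff ℝ ∞ f) (hg : ContDiff ℝ ∞ g) : ContDiff ℝ ∞ (f + g) :=
  hf.add hg
theorem sm_smul {f : V → ℂ} (hf : ContDiff ℝ ∞ f) (c : ℂ) : ContDiff ℝ ∞ (c • f) :=
  hf.const_smul c
theorem Dv_smul {f : V → ℂ} (hf : ContDiff ℝ ∞ f) (c : ℂ) (v : V) :
    Dv v (c • f) = c • Dv v f := by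
  funext x
  simp [Dv, fderiv_const_smul (smooth_diff hf x)]
theorem Dv_sum {ι : Type*} (s : Finset ι) {f : ι → V → W} (hf : ∀ i, ContDiff ℝ ∞ (f i)) (v : V) :
    Dv v (∑ i ∈ s, f i) = ∑ i ∈ s, Dv v (f i) := by
  funext x
  simp [Dv, fderiv_sum (fun i _ => smooth_diff (hf i) x)]

/-- Schwartz decay, locally uniformly in time. -/
def Dec (F : ℝ → V → ℂ) : Prop :=
  (∀ t, ContDiff ℝ ∞ (F t)) ∧ ∀ (m N : ℕ) (T : ℝ), ∃ C : ℝ, ∀ t : ℝ, |t| ≤ T → ∀ q : V,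
    (1 + ‖q‖) ^ N * ‖iteratedFDeriv ℝ m (F t) q‖ ≤ C

theorem Dec.D {F : ℝ → V → ℂ} (hF : Dec F) (v : V) : Dec (fun t => Dv v (F t)) := by
  refine ⟨fun t => Dv_smooth (hF.1 t) v, fun m N T => ?_⟩
  obtain ⟨C, hC⟩ := hF.2 (m + 1) N T
  refine ⟨‖v‖ * C, fun t ht q => ?_⟩
  have h1 : ‖iteratedFDeriv ℝ m (Dv v (F t)) q‖ ≤ ‖v‖ * ‖iteratedFDeriv ℝ (m+1) (F t) q‖ := by
    rw [← norm_iteratedFDeriv_fderiv]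
    have : ContDiff ℝ ∞ (fderiv ℝ (F t)) := (hF.1 t).fderiv_right (by simp)
    exact norm_iteratedFDeriv_clm_apply_const this.contDiffAt (by exact_mod_cast le_top)
  calc _ ≤ (1 + ‖q‖) ^ N * (‖v‖ * ‖iteratedFDeriv ℝ (m+1) (F t) q‖) := by gcongr
    _ = ‖v‖ * ((1 + ‖q‖) ^ N * ‖iteratedFDeriv ℝ (m+1) (F t) q‖) := by ring
    _ ≤ _ := by gcongr; exact hC t ht q

theorem Dec.add {F G : ℝ → V → ℂ} (hF : Dec F) (hG : Dec G) : Dec (fun t => F t + G t) := by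
  refine ⟨fun t => (hF.1 t).add (hG.1 t), fun m N T => ?_⟩
  obtain ⟨C, hC⟩ := hF.2 m N T
  obtain ⟨C', hC'⟩ := hG.2 m N T
  refine ⟨C + C', fun t ht q => ?_⟩
  rw [iteratedFDeriv_add_apply ((hF.1 t).contDiffAt.of_le (by exact_mod_cast le_top))
    ((hG.1 t).contDiffAt.of_le (by exact_mod_cast le_top))]
  calc _ ≤ (1 + ‖q‖) ^ N * (‖iteratedFDeriv ℝ m (F t) q‖ + ‖iteratedFDeriv ℝ m (G t) q‖) := by
        gcongr; exact norm_add_le _ _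
    _ ≤ _ := by rw [mul_add]; exact add_le_add (hC t ht q) (hC' t ht q)

theorem Dec.smul {F : ℝ → V → ℂ} (hF : Dec F) (c : ℂ) : Dec (fun t => c • F t) := by
  refine ⟨fun t => (hF.1 t).const_smul c, fun m N T => ?_⟩
  obtain ⟨C, hC⟩ := hF.2 m N T
  refine ⟨‖c‖ * C, fun t ht q => ?_⟩
  rw [iteratedFDeriv_const_smul_apply ((hF.1 t).contDiffAt.of_le (by exact_mod_cast le_top)),
    norm_smul]
  calc _ = ‖c‖ * ((1 + ‖q‖) ^ N * ‖iteratedFDeriv ℝ m (F t) q‖) := by ring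
    _ ≤ _ := by gcongr; exact hC t ht q

theorem Dec.sub {F G : ℝ → V → ℂ} (hF : Dec F) (hG : Dec G) : Dec (fun t => F t - G t) := by
  convert hF.add (hG.smul (-1)) using 2
  module

theorem Dec.zero : Dec (fun _ => (0 : V → ℂ)) := by
  refine ⟨fun t => contDiff_const, fun m N T => ⟨0, fun t ht q => ?_⟩⟩
  simp

theorem Dec.sum {ι : Type*} (s : Finset ι) {F : ι → ℝ → V → ℂ} (hF : ∀ i, Dec (F i)) :
    Dec (fun t => ∑ i ∈ s, F i t) := by
  classical
  induction s using Finset.induction_on with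
  | empty => simpa using Dec.zero
  | insert a s ha ih => simpa [ha] using (hF a).add ih

theorem Dec.comp {F : ℝ → V → ℂ} (hF : Dec F) (L : U →L[ℝ] V) (hL : ∀ u, ‖u‖ ≤ ‖L u‖) :
    Dec (fun t => F t ∘ L) := by
  refine ⟨fun t => (hF.1 t).comp L.contDiff, fun m N T => ?_⟩
  obtain ⟨C, hC⟩ := hF.2 m N T
  refine ⟨C * ‖L‖ ^ m, fun t ht q => ?_⟩
  rw [L.iteratedFDeriv_comp_right (hF.1 t) q (by exact_mod_cast le_top)]
  have h1 := (iteratedFDeriv ℝ m (F t) (L q)).norm_compContinuousLinearMap_le (fun _ => L)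
  simp only [Finset.prod_const, Finset.card_univ, Fintype.card_fin] at h1
  calc _ ≤ (1 + ‖L q‖) ^ N * (‖iteratedFDeriv ℝ m (F t) (L q)‖ * ‖L‖ ^ m) := by
        gcongr; exact hL q
    _ = ((1 + ‖L q‖) ^ N * ‖iteratedFDeriv ℝ m (F t) (L q)‖) * ‖L‖ ^ m := by ring
    _ ≤ _ := by gcongr; exact hC t ht _

theorem TG_D {φ : V → ℝ} (h : φ.HasTemperateGrowth) (v : V) : (Dv v φ).HasTemperateGrowth := by
  refine ⟨Dv_smooth h.1 v, fun n => ?_⟩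
  obtain ⟨k, C, hC⟩ := h.2 (n + 1)
  refine ⟨k, ‖v‖ * C, fun x => ?_⟩
  have h1 : ‖iteratedFDeriv ℝ n (Dv v φ) x‖ ≤ ‖v‖ * ‖iteratedFDeriv ℝ (n+1) φ x‖ := by
    rw [← norm_iteratedFDeriv_fderiv]
    have : ContDiff ℝ ∞ (fderiv ℝ φ) := h.1.fderiv_right (by simp)
    exact norm_iteratedFDeriv_clm_apply_const this.contDiffAt (by exact_mod_cast le_top)
  refine h1.trans ?_
  rw [mul_assoc]
  gcongr
  exact hC x

variable [FiniteDimensional ℝ V] [MeasurableSpace V] [BorelSpace V]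

theorem dom_bound {φ : V → ℝ} (hφ : φ.HasTemperateGrowth) {F : ℝ → V → ℂ} (hF : Dec F) (T : ℝ) :
    ∃ C : ℝ, ∀ t, |t| ≤ T → ∀ x, ‖φ x • F t x‖ ≤
      C * (1 + ‖x‖) ^ (-((Module.finrank ℝ V + 1 : ℕ) : ℝ)) := by
  obtain ⟨k, C, hC⟩ := hφ.2 0
  obtain ⟨C', hC'⟩ := hF.2 0 (k + (Module.finrank ℝ V + 1)) T
  refine ⟨C * C', fun t ht x => ?_⟩
  have h1 := hC x
  have h2 := hC' t ht x
  simp only [norm_iteratedFDeriv_zero] at h1 h2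
  have hp : 0 < 1 + ‖x‖ := by positivity
  rw [Real.rpow_neg hp.le, Real.rpow_natCast, ← div_eq_mul_inv, le_div_iff₀ (by positivity),
    norm_smul]
  have hC0 : 0 ≤ C := by
    by_contra h
    have : C * (1 + ‖x‖) ^ k < 0 := mul_neg_of_neg_of_pos (by linarith) (by positivity)
    linarith [norm_nonneg (φ x)]
  calc _ ≤ (C * (1 + ‖x‖) ^ k) * ‖F t x‖ * (1 + ‖x‖) ^ (Module.finrank ℝ V + 1) := by gcongr
    _ = C * ((1 + ‖x‖) ^ (k + (Module.finrank ℝ V + 1)) * ‖F t x‖) := by rw [pow_add]; ring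
    _ ≤ _ := by gcongr

theorem bound_integrable (μ : Measure V) [μ.IsAddHaarMeasure] (C : ℝ) :
    Integrable (fun x : V => C * (1 + ‖x‖) ^ (-((Module.finrank ℝ V + 1 : ℕ) : ℝ))) μ := by
  refine (integrable_one_add_norm ?_).const_mul C
  push_cast; linarith

theorem TG_integrable {φ : V → ℝ} (hφ : φ.HasTemperateGrowth) {F : ℝ → V → ℂ} (hF : Dec F)
    (μ : Measure V) [μ.IsAddHaarMeasure] (t : ℝ) : Integrable (fun x => φ x • F t x) μ := by
  obtain ⟨C, hC⟩ := dom_bound hφ hF |t|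
  refine (bound_integrable μ C).mono' ?_ (ae_of_all _ fun x => hC t le_rfl x)
  exact (hφ.1.continuous.smul (hF.1 t).continuous).aestronglyMeasurable

theorem ibp {φ : V → ℝ} (hφ : φ.HasTemperateGrowth) {F : ℝ → V → ℂ} (hF : Dec F)
    (μ : Measure V) [μ.IsAddHaarMeasure] (t : ℝ) (v : V) :
    ∫ x, φ x • Dv v (F t) x ∂μ = - ∫ x, Dv v φ x • F t x ∂μ :=
  integral_smul_fderiv_eq_neg_fderiv_smul_of_integrable
    (TG_integrable (TG_D hφ v) hF μ t) (TG_integrable hφ (hF.D v) μ t) (TG_integrable hφ hF μ t)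
    (fun x _ => smooth_diff hφ.1 x) (fun x _ => smooth_diff (hF.1 t) x)

end gen

section red
set_option linter.unusedSectionVars false
variable {V U W : Type*} [NormedAddCommGroup V] [NormedSpace ℝ V] [NormedAddCommGroup U]
    [NormedSpace ℝ U] [NormedAddCommGroup W] [NormedSpace ℝ W]

theorem slice_left {f : V × W → ℂ} (hf : ContDiff ℝ ∞ f) (L : U →L[ℝ] V) (w : W) (u e : U) :
    fderiv ℝ (fun z => f (L z, w)) u e = Dv (L e, (0 : W)) f (L u, w) := by
  have h1 : HasFDerivAt (fun z => (L z, w)) (L.prod (0 : U →L[ℝ] W)) u :=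
    L.hasFDerivAt.prodMk (hasFDerivAt_const w u)
  have := ((smooth_diff hf (L u, w)).hasFDerivAt.comp u h1).fderiv
  change fderiv ℝ (f ∘ fun z => (L z, w)) u e = _
  rw [this]; simp [Dv]

theorem slice_right {f : V × W → ℂ} (hf : ContDiff ℝ ∞ f) (L : U →L[ℝ] W) (v : V) (u e : U) :
    fderiv ℝ (fun z => f (v, L z)) u e = Dv ((0 : V), L e) f (v, L u) := by
  have h1 : HasFDerivAt (fun z => (v, L z)) ((0 : U →L[ℝ] V).prod L) u :=
    (hasFDerivAt_const v u).prodMk L.hasFDerivAt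
  have := ((smooth_diff hf (v, L u)).hasFDerivAt.comp u h1).fderiv
  change fderiv ℝ (f ∘ fun z => (v, L z)) u e = _
  rw [this]; simp [Dv]

theorem time_comm {G : ℝ × V → ℂ} (hG : ContDiff ℝ ∞ G) (v q : V) (t : ℝ) :
    HasDerivAt (fun s => Dv v (fun q => G (s, q)) q)
      (Dv v (fun q => deriv (fun s => G (s, q)) t) q) t := by
  have e1 : ∀ s, Dv v (fun q => G (s, q)) q = Dv ((0 : ℝ), v) G (s, q) := fun s =>
    slice_right hG (ContinuousLinearMap.id ℝ V) s q v
  have e2 : ∀ {H : ℝ × V → ℂ}, ContDiff ℝ ∞ H → ∀ q,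
      HasDerivAt (fun s => H (s, q)) (Dv ((1 : ℝ), (0 : V)) H (t, q)) t := by
    intro H hH q
    have h := slice_left hH (ContinuousLinearMap.id ℝ ℝ) q t 1
    have hd : DifferentiableAt ℝ (fun s => H (s, q)) t := by
      have := smooth_diff hH
      fun_prop
    have h2 := hd.hasFDerivAt.hasDerivAt
    rwa [show (fderiv ℝ (fun s => H (s, q)) t) 1 = _ from h] at h2
  simp only [e1]
  have e3 : (fun q => deriv (fun s => G (s, q)) t) = fun q => Dv ((1 : ℝ), (0 : V)) G (t, q) := by
    funext q; exact (e2 hG q).deriv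
  have h4 : Dv v (fun q => Dv ((1 : ℝ), (0 : V)) G (t, q)) q
      = Dv ((0 : ℝ), v) (Dv ((1 : ℝ), (0 : V)) G) (t, q) :=
    slice_right (Dv_smooth hG _) (ContinuousLinearMap.id ℝ V) t q v
  rw [e3, h4, Dv_comm hG]
  exact e2 (Dv_smooth hG _) q

theorem tri_identity (T : V → V → V → ℂ)
    (h1 : ∀ u u' v w, T (u + u') v w = T u v w + T u' v w)
    (h2 : ∀ u v v' w, T u (v + v') w = T u v w + T u v' w)
    (h3 : ∀ u v w w', T u v (w + w') = T u v w + T u v w')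
    (s1 : ∀ u v w, T u v w = T v u w) (s2 : ∀ u v w, T u v w = T u w v) (a b c e : V) :
    (T a c c - T b c c) - (T a e e - T b e e)
      = T (c + e) (a + b) (c + e) - 2 * (T (c + e) e a + T (c + e) b c) := by
  simp only [h1, h2, h3]
  have q1 : T c a c = T a c c := s1 _ _ _
  have q2 : T c a e = T a c e := s1 _ _ _
  have q3 : T e a c = T a c e := by rw [s1, s2]
  have q4 : T e a e = T a e e := s1 _ _ _
  have q5 : T c b c = T b c c := s1 _ _ _
  have q6 : T c b e = T b c e := s1 _ _ _
  have q7 : T e b c = T b c e := by rw [s1, s2]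
  have q8 : T e b e = T b e e := s1 _ _ _
  have q9 : T c e a = T a c e := by rw [s2, s1]
  have q10 : T e e a = T a e e := by rw [s2, s1]
  rw [q1, q2, q3, q4, q5, q6, q7, q8, q9, q10]
  ring

end red

section gp
variable {d : ℕ}

/-- Kernel as a function on the product. -/
def Gam (γ : (k : ℕ) → ℝ → (Fin k → Ed d) → (Fin k → Ed d) → ℂ) (k : ℕ) (t : ℝ) :
    (Fin k → Ed d) × (Fin k → Ed d) → ℂ := fun r => γ k t r.1 r.2

/-- Standard basis vector. -/
def eb (ℓ : Fin d) : Ed d := EuclideanSpace.single ℓ 1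

/-- `onePt` as a continuous linear map. -/
def oneL (d : ℕ) : Ed d →L[ℝ] (Fin 1 → Ed d) :=
  ContinuousLinearMap.pi fun _ => ContinuousLinearMap.id ℝ _

theorem oneL_apply (x : Ed d) : oneL d x = onePt x := rfl

/-- Diagonal embeddings. -/
def diag (d k : ℕ) : Ed d →L[ℝ] (Fin k → Ed d) × (Fin k → Ed d) :=
  (ContinuousLinearMap.pi fun _ => ContinuousLinearMap.id ℝ _).prod
    (ContinuousLinearMap.pi fun _ => ContinuousLinearMap.id ℝ _)

theorem diag_norm {k : ℕ} (x : Ed d) : ‖x‖ ≤ ‖diag d (k + 1) x‖ := by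
  refine le_trans ?_ (norm_fst_le _)
  exact norm_le_pi_norm (fun _ : Fin (k + 1) => x) 0

/-- First collision map. -/
def L1 (d : ℕ) : (Fin 1 → Ed d) × (Fin 1 → Ed d) →L[ℝ] (Fin 2 → Ed d) × (Fin 2 → Ed d) :=
  (ContinuousLinearMap.pi fun i => (![ContinuousLinearMap.proj 0 ∘L ContinuousLinearMap.fst ℝ _ _,
      ContinuousLinearMap.proj 0 ∘L ContinuousLinearMap.fst ℝ _ _] : Fin 2 → _) i).prod
    (ContinuousLinearMap.pi fun i => (![ContinuousLinearMap.proj 0 ∘L ContinuousLinearMap.snd ℝ _ _,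
      ContinuousLinearMap.proj 0 ∘L ContinuousLinearMap.fst ℝ _ _] : Fin 2 → _) i)

/-- Second collision map. -/
def L2 (d : ℕ) : (Fin 1 → Ed d) × (Fin 1 → Ed d) →L[ℝ] (Fin 2 → Ed d) × (Fin 2 → Ed d) :=
  (ContinuousLinearMap.pi fun i => (![ContinuousLinearMap.proj 0 ∘L ContinuousLinearMap.fst ℝ _ _,
      ContinuousLinearMap.proj 0 ∘L ContinuousLinearMap.snd ℝ _ _] : Fin 2 → _) i).prod
    (ContinuousLinearMap.pi fun i => (![ContinuousLinearMap.proj 0 ∘L ContinuousLinearMap.snd ℝ _ _,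
      ContinuousLinearMap.proj 0 ∘L ContinuousLinearMap.snd ℝ _ _] : Fin 2 → _) i)

theorem L1_apply (q : (Fin 1 → Ed d) × (Fin 1 → Ed d)) :
    L1 d q = (![q.1 0, q.1 0], ![q.2 0, q.1 0]) := by
  refine Prod.ext ?_ ?_ <;> funext i <;> fin_cases i <;> rfl

theorem L2_apply (q : (Fin 1 → Ed d) × (Fin 1 → Ed d)) :
    L2 d q = (![q.1 0, q.2 0], ![q.2 0, q.2 0]) := by
  refine Prod.ext ?_ ?_ <;> funext i <;> fin_cases i <;> rfl

/-- Particle swap. -/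
def Sw (d : ℕ) : (Fin 2 → Ed d) × (Fin 2 → Ed d) →L[ℝ] (Fin 2 → Ed d) × (Fin 2 → Ed d) :=
  (ContinuousLinearMap.pi fun i => ContinuousLinearMap.proj (Equiv.swap (0 : Fin 2) 1 i)).prodMap
    (ContinuousLinearMap.pi fun i => ContinuousLinearMap.proj (Equiv.swap (0 : Fin 2) 1 i))

variable {lam : ℝ} {γ : (k : ℕ) → ℝ → (Fin k → Ed d) → (Fin k → Ed d) → ℂ}

theorem gam_joint (hγ : GPSolution d lam γ) (k : ℕ) :
    ContDiff ℝ ∞ (fun q : ℝ × ((Fin k → Ed d) × (Fin k → Ed d)) => Gam γ k q.1 q.2) := hγ.smooth k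

theorem gam_dec (hγ : GPSolution d lam γ) (k : ℕ) : Dec (Gam γ k) := by
  refine ⟨fun t => ?_, fun m N T => hγ.decay k m N T⟩
  exact (gam_joint hγ k).comp (contDiff_const.prodMk contDiff_id)

/-- Direction in the unprimed variable. -/
def ua (ℓ : Fin d) : (Fin 1 → Ed d) × (Fin 1 → Ed d) := (oneL d (eb ℓ), 0)
/-- Direction in the primed variable. -/
def ub (ℓ : Fin d) : (Fin 1 → Ed d) × (Fin 1 → Ed d) := (0, oneL d (eb ℓ))

theorem diag_eb (ℓ : Fin d) : diag d 1 (eb ℓ) = ua ℓ + ub ℓ := by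
  refine Prod.ext ?_ ?_ <;> funext i <;> simp [diag, ua, ub, oneL]

theorem single_eq (j : Fin 1) (ℓ : Fin d) :
    (Pi.single j (EuclideanSpace.single ℓ 1) : Fin 1 → Ed d) = oneL d (eb ℓ) := by
  funext i
  have : i = j := Subsingleton.elim _ _
  subst this
  simp [oneL, eb]

theorem lap_left (hγ : GPSolution d lam γ) (t : ℝ) (q : (Fin 1 → Ed d) × (Fin 1 → Ed d))
    (j : Fin 1) :
    lapAt j (fun z => γ 1 t z q.2) q.1 = ∑ ℓ, Dv (ua ℓ) (Dv (ua ℓ) (Gam γ 1 t)) q := by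
  unfold lapAt
  refine Finset.sum_congr rfl fun ℓ _ => ?_
  have hs := (gam_dec hγ 1).1 t
  rw [single_eq]
  have h1 : ∀ z, fderiv ℝ (fun z => γ 1 t z q.2) z (oneL d (eb ℓ))
      = Dv (ua ℓ) (Gam γ 1 t) (z, q.2) := fun z =>
    slice_left hs (ContinuousLinearMap.id ℝ _) q.2 z _
  simp only [h1]
  exact slice_left (Dv_smooth hs _) (ContinuousLinearMap.id ℝ _) q.2 q.1 _

theorem lap_right (hγ : GPSolution d lam γ) (t : ℝ) (q : (Fin 1 → Ed d) × (Fin 1 → Ed d))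
    (j : Fin 1) :
    lapAt j (γ 1 t q.1) q.2 = ∑ ℓ, Dv (ub ℓ) (Dv (ub ℓ) (Gam γ 1 t)) q := by
  unfold lapAt
  refine Finset.sum_congr rfl fun ℓ _ => ?_
  have hs := (gam_dec hγ 1).1 t
  rw [single_eq]
  have h1 : ∀ z, fderiv ℝ (γ 1 t q.1) z (oneL d (eb ℓ))
      = Dv (ub ℓ) (Gam γ 1 t) (q.1, z) := fun z =>
    slice_right hs (ContinuousLinearMap.id ℝ _) q.1 z _
  simp only [h1]
  exact slice_right (Dv_smooth hs _) (ContinuousLinearMap.id ℝ _) q.1 q.2 _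

theorem coll_eq (t : ℝ) (q : (Fin 1 → Ed d) × (Fin 1 → Ed d)) :
    Bcoll (γ (1 + 1) t) q.1 q.2 = (Gam γ 2 t ∘ L1 d) q - (Gam γ 2 t ∘ L2 d) q := by
  have hsn : ∀ (x : Fin 1 → Ed d) (y : Ed d),
      (Fin.snoc (α := fun _ => Ed d) x y : Fin 2 → Ed d) = ![x 0, y] := by
    intro x y
    funext i
    fin_cases i
    · rfl
    · rfl
  simp only [Bcoll, Finset.univ_unique, Finset.sum_singleton, Function.comp, L1_apply, L2_apply,
    Gam]
  erw [hsn, hsn, hsn, hsn]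
  rfl

theorem dt_eq (hγ : GPSolution d lam γ) (t : ℝ) :
    (fun q => deriv (fun s => Gam γ 1 s q) t)
      = Complex.I • (∑ j, (Dv (ua j) (Dv (ua j) (Gam γ 1 t)) - Dv (ub j) (Dv (ub j) (Gam γ 1 t))))
        - (Complex.I * lam) • (Gam γ 2 t ∘ L1 d - Gam γ 2 t ∘ L2 d) := by
  funext q
  have h := hγ.eq 1 t q.1 q.2
  rw [coll_eq] at h
  simp only [Finset.univ_unique, Finset.sum_singleton, lap_left hγ, lap_right hγ] at h
  have h2 := congrArg (fun z => -Complex.I * z) h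
  simp only [← mul_assoc, neg_mul, Complex.I_mul_I, neg_neg, one_mul] at h2
  change deriv (fun s => γ 1 s q.1 q.2) t = _
  rw [h2]
  simp only [Pi.sub_apply, Pi.smul_apply, Finset.sum_apply, smul_eq_mul, Finset.sum_sub_distrib]
  ring

/-- One-particle density. -/
def rho (γ : (k : ℕ) → ℝ → (Fin k → Ed d) → (Fin k → Ed d) → ℂ) (k : ℕ) (t : ℝ) : Ed d → ℂ :=
  Gam γ k t ∘ diag d k

/-- Mixed derivative on the diagonal. -/
def mix (γ : (k : ℕ) → ℝ → (Fin k → Ed d) → (Fin k → Ed d) → ℂ) (ℓ j : Fin d) (t : ℝ) : Ed d → ℂ :=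
  Dv (ub j) (Dv (ua ℓ) (Gam γ 1 t)) ∘ diag d 1

/-- Time derivative of the momentum density. -/
def Qd (lam : ℝ) (γ : (k : ℕ) → ℝ → (Fin k → Ed d) → (Fin k → Ed d) → ℂ) (ℓ : Fin d) (t : ℝ) :
    Ed d → ℂ :=
  (1 / 2 : ℂ) • (∑ j, Dv (eb j) (Dv (eb ℓ) (Dv (eb j) (rho γ 1 t))
      - (2 : ℂ) • (mix γ ℓ j t + mix γ j ℓ t)))
    - ((lam : ℂ) / 2) • Dv (eb ℓ) (rho γ 2 t)

theorem rho_dec (hγ : GPSolution d lam γ) (k : ℕ) : Dec (rho γ (k + 1)) :=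
  (gam_dec hγ (k + 1)).comp _ diag_norm

theorem mix_dec (hγ : GPSolution d lam γ) (ℓ j : Fin d) : Dec (mix γ ℓ j) :=
  (((gam_dec hγ 1).D _).D _).comp _ (diag_norm (k := 0))

theorem inner_dec (hγ : GPSolution d lam γ) (ℓ j : Fin d) :
    Dec (fun t => Dv (eb ℓ) (Dv (eb j) (rho γ 1 t)) - (2 : ℂ) • (mix γ ℓ j t + mix γ j ℓ t)) :=
  (((rho_dec hγ 0).D _).D _).sub (((mix_dec hγ ℓ j).add (mix_dec hγ j ℓ)).smul 2)

theorem Qd_dec (hγ : GPSolution d lam γ) (ℓ : Fin d) : Dec (Qd lam γ ℓ) :=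
  ((Dec.sum _ fun j => (inner_dec hγ ℓ j).D (eb j)).smul _).sub (((rho_dec hγ 1).D _).smul _)

theorem Pmom_eq (hγ : GPSolution d lam γ) (ℓ : Fin d) (s : ℝ) (x : Ed d) :
    Pmom (γ 1 s) ℓ x = (1 / (2 * Complex.I)) * Dv (ua ℓ - ub ℓ) (Gam γ 1 s) (diag d 1 x) := by
  have hs := (gam_dec hγ 1).1 s
  unfold Pmom
  have h1 := slice_left hs (oneL d) (oneL d x) x (eb ℓ)
  have h2 := slice_right hs (oneL d) (oneL d x) x (eb ℓ)
  rw [Dv_sub_dir]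
  congr 1
  exact congrArg₂ (· - ·) h1 h2

theorem pair_term (hγ : GPSolution d lam γ) (ℓ : Fin d) (t : ℝ) (x : Ed d) :
    Dv (ua ℓ - ub ℓ) (Gam γ 2 t ∘ L1 d - Gam γ 2 t ∘ L2 d) (diag d 1 x)
      = Dv (eb ℓ) (rho γ 2 t) x := by
  have hs := (gam_dec hγ 2).1 t
  have hS : Gam γ 2 t ∘ Sw d = Gam γ 2 t := by
    funext q
    exact hγ.symm 2 t (Equiv.swap 0 1) q.1 q.2
  let w0 : (Fin 2 → Ed d) × (Fin 2 → Ed d) := (![eb ℓ, 0], ![eb ℓ, 0])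
  let w1 : (Fin 2 → Ed d) × (Fin 2 → Ed d) := (![0, eb ℓ], ![0, eb ℓ])
  have hw : Sw d w0 = w1 := by
    refine Prod.ext ?_ ?_ <;> funext i <;> fin_cases i <;> simp [Sw, w0, w1]
  have hx : Sw d (diag d 2 x) = diag d 2 x := by
    refine Prod.ext ?_ ?_ <;> funext i <;> fin_cases i <;> simp [Sw, diag]
  have hsym : Dv w0 (Gam γ 2 t) (diag d 2 x) = Dv w1 (Gam γ 2 t) (diag d 2 x) := by
    conv_lhs => rw [← hS, Dv_comp hs]
    simp only [Function.comp, hw, hx]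
  have e1 : L1 d (diag d 1 x) = diag d 2 x := by
    rw [L1_apply]
    refine Prod.ext ?_ ?_ <;> funext i <;> fin_cases i <;> simp [diag]
  have e2 : L2 d (diag d 1 x) = diag d 2 x := by
    rw [L2_apply]
    refine Prod.ext ?_ ?_ <;> funext i <;> fin_cases i <;> simp [diag]
  have e3 : L1 d (ua ℓ - ub ℓ) - L2 d (ua ℓ - ub ℓ) = w1 + w1 := by
    rw [L1_apply, L2_apply]
    refine Prod.ext ?_ ?_ <;> funext i <;> fin_cases i <;> simp [ua, ub, oneL, w1]
  have e4 : diag d 2 (eb ℓ) = w0 + w1 := by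
    refine Prod.ext ?_ ?_ <;> funext i <;> fin_cases i <;> simp [diag, w0, w1]
  rw [Dv_sub (hs.comp (L1 d).contDiff) (hs.comp (L2 d).contDiff), Dv_comp hs, Dv_comp hs, rho,
    Dv_comp hs]
  simp only [Pi.sub_apply, Function.comp, e1, e2, e4]
  rw [← Pi.sub_apply, ← Dv_sub_dir, e3, Dv_add_dir, Dv_add_dir]
  simp only [Pi.add_apply, hsym]

theorem kin_term (hγ : GPSolution d lam γ) (ℓ j : Fin d) (t : ℝ) (x : Ed d) :
    Dv (ua ℓ - ub ℓ) (Dv (ua j) (Dv (ua j) (Gam γ 1 t)) - Dv (ub j) (Dv (ub j) (Gam γ 1 t)))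
        (diag d 1 x)
      = Dv (eb j) (Dv (eb ℓ) (Dv (eb j) (rho γ 1 t))
        - (2 : ℂ) • (mix γ ℓ j t + mix γ j ℓ t)) x := by
  have hs := (gam_dec hγ 1).1 t
  have hD : ∀ u v, ContDiff ℝ ∞ (Dv u (Dv v (Gam γ 1 t))) := fun u v =>
    Dv_smooth (Dv_smooth hs _) _
  have hm : ∀ ℓ j, ContDiff ℝ ∞ (mix γ ℓ j t) := fun ℓ j => (mix_dec hγ ℓ j).1 t
  have hr : ContDiff ℝ ∞ (rho γ 1 t) := (rho_dec hγ 0).1 t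
  have key := tri_identity (fun u v w => Dv u (Dv v (Dv w (Gam γ 1 t))) (diag d 1 x))
    (fun u u' v w => by simp only [Dv_add_dir, Pi.add_apply])
    (fun u v v' w => by
      rw [Dv_add_dir, Dv_add (hD _ _) (hD _ _)]; rfl)
    (fun u v w w' => by
      rw [Dv_add_dir, Dv_add (Dv_smooth hs _) (Dv_smooth hs _), Dv_add (hD _ _) (hD _ _)]; rfl)
    (fun u v w => by rw [Dv_comm (Dv_smooth hs w)])
    (fun u v w => by rw [Dv_comm hs v w]) (ua ℓ) (ub ℓ) (ua j) (ub j)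
  rw [Dv_sub (hD _ _) (hD _ _), Dv_sub_dir, Dv_sub_dir]
  rw [Dv_sub (Dv_smooth (Dv_smooth hr _) _) (sm_smul (sm_add (hm _ _) (hm _ _)) _),
    Dv_smul (sm_add (hm _ _) (hm _ _)), Dv_add (hm _ _) (hm _ _)]
  simp only [mix, rho]
  rw [Dv_comp hs, Dv_comp (Dv_smooth hs _), Dv_comp (hD _ _), Dv_comp (hD _ _), Dv_comp (hD _ _),
    diag_eb, diag_eb]
  simp only [Pi.sub_apply, Pi.add_apply, Pi.smul_apply, smul_eq_mul, Function.comp]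
  exact key

theorem P_deriv (hγ : GPSolution d lam γ) (ℓ : Fin d) (t : ℝ) (x : Ed d) :
    HasDerivAt (fun s => Pmom (γ 1 s) ℓ x) (Qd lam γ ℓ t x) t := by
  simp only [Pmom_eq hγ]
  have h := (time_comm (gam_joint hγ 1) (ua ℓ - ub ℓ) (diag d 1 x) t).const_mul
    (1 / (2 * Complex.I))
  refine h.congr_deriv ?_
  have hs := (gam_dec hγ 1).1 t
  have hs2 := (gam_dec hγ 2).1 t
  have hD : ∀ u v, ContDiff ℝ ∞ (Dv u (Dv v (Gam γ 1 t))) := fun u v =>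
    Dv_smooth (Dv_smooth hs _) _
  have hc1 : ContDiff ℝ ∞ (Gam γ 2 t ∘ L1 d - Gam γ 2 t ∘ L2 d) :=
    (hs2.comp (L1 d).contDiff).sub (hs2.comp (L2 d).contDiff)
  have hc2 : ∀ j, ContDiff ℝ ∞
      (Dv (ua j) (Dv (ua j) (Gam γ 1 t)) - Dv (ub j) (Dv (ub j) (Gam γ 1 t))) :=
    fun j => (hD _ _).sub (hD _ _)
  have hc3 : ContDiff ℝ ∞
      (∑ j, (Dv (ua j) (Dv (ua j) (Gam γ 1 t)) - Dv (ub j) (Dv (ub j) (Gam γ 1 t)))) := by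
    have := ContDiff.sum (s := Finset.univ) (fun j (_ : j ∈ Finset.univ) => hc2 j)
    convert this using 1
    funext q; simp
  have e := dt_eq hγ t
  change (fun q => deriv (fun s => Gam γ 1 s q) t) = _ at e
  change 1 / (2 * Complex.I) * Dv (ua ℓ - ub ℓ) (fun q => deriv (fun s => Gam γ 1 s q) t)
    (diag d 1 x) = _
  rw [e, Dv_sub (sm_smul hc3 _) (sm_smul hc1 _), Dv_smul hc3, Dv_smul hc1, Dv_sum _ hc2]
  simp only [Pi.sub_apply, Pi.smul_apply, Finset.sum_apply, smul_eq_mul, pair_term hγ,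
    kin_term hγ, Qd]
  field_simp

end gp

theorem deriv_int {V : Type*} [NormedAddCommGroup V] [NormedSpace ℝ V] [FiniteDimensional ℝ V]
    [MeasurableSpace V] [BorelSpace V] (μ : Measure V) [μ.IsAddHaarMeasure]
    {φ : V → ℝ} (hφ : φ.HasTemperateGrowth) {P Q : ℝ → V → ℂ} (hP : Dec P) (hQ : Dec Q)
    (hd : ∀ t x, HasDerivAt (fun s => P s x) (Q t x) t) (t : ℝ) :
    HasDerivAt (fun s => ∫ x, φ x • P s x ∂μ) (∫ x, φ x • Q t x ∂μ) t := by
  obtain ⟨C, hC⟩ := dom_bound hφ hQ (|t| + 1)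
  refine (hasDerivAt_integral_of_dominated_loc_of_deriv_le (F := fun s x => φ x • P s x)
    (F' := fun s x => φ x • Q s x) (Metric.ball_mem_nhds t one_pos)
    (Filter.Eventually.of_forall fun s => (TG_integrable hφ hP μ s).aestronglyMeasurable)
    (TG_integrable hφ hP μ t) (TG_integrable hφ hQ μ t).aestronglyMeasurable
    (ae_of_all _ fun x s hs => hC s ?_ x) (bound_integrable μ C)
    (ae_of_all _ fun x s _ => (hd s x).const_smul (φ x))).2
  rw [Metric.mem_ball, Real.dist_eq] at hs
  have := abs_sub_abs_le_abs_sub s t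
  linarith

theorem rpdE_eq {d : ℕ} (j : Fin d) (f : Ed d → ℝ) : rpdE j f = Dv (eb j) f := rfl

section fin
variable {d : ℕ} {lam : ℝ} {γ : (k : ℕ) → ℝ → (Fin k → Ed d) → (Fin k → Ed d) → ℂ}

theorem P_dec (hγ : GPSolution d lam γ) (ℓ : Fin d) : Dec (fun s => Pmom (γ 1 s) ℓ) := by
  have h := (((gam_dec hγ 1).D (ua ℓ - ub ℓ)).comp _ (diag_norm (k := 0))).smul (1 / (2 * Complex.I))
  convert h using 2 with s
  funext x
  rw [Pmom_eq hγ]; rfl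

theorem mix_eq (hγ : GPSolution d lam γ) (ℓ j : Fin d) (t : ℝ) (x : Ed d) :
    fderiv ℝ (fun z' => fderiv ℝ (fun z => γ 1 t (onePt z) (onePt z')) x
      (EuclideanSpace.single ℓ 1)) x (EuclideanSpace.single j 1) = mix γ ℓ j t x := by
  have hs := (gam_dec hγ 1).1 t
  have h1 : ∀ z' : Ed d, fderiv ℝ (fun z => γ 1 t (onePt z) (onePt z')) x
      (EuclideanSpace.single ℓ 1) = Dv (ua ℓ) (Gam γ 1 t) (oneL d x, oneL d z') := fun z' =>
    slice_left hs (oneL d) (oneL d z') x (eb ℓ)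
  simp only [h1]
  exact slice_right (Dv_smooth hs _) (oneL d) (oneL d x) x (eb j)

theorem int_inner (hγ : GPSolution d lam γ) {a : Ed d → ℝ} (ha : a.HasTemperateGrowth)
    (ℓ j : Fin d) (t : ℝ) :
    ∫ x, Dv (eb ℓ) a x • Dv (eb j) (Dv (eb ℓ) (Dv (eb j) (rho γ 1 t))
      - (2 : ℂ) • (mix γ ℓ j t + mix γ j ℓ t)) x
    = - (∫ x, Dv (eb j) (Dv (eb ℓ) (Dv (eb j) (Dv (eb ℓ) a))) x • rho γ 1 t x)
      + 2 * (∫ x, Dv (eb j) (Dv (eb ℓ) a) x • mix γ ℓ j t x)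
      + 2 * (∫ x, Dv (eb ℓ) (Dv (eb j) a) x • mix γ j ℓ t x) := by
  have hr : Dec (rho γ 1) := rho_dec hγ 0
  have ha1 := TG_D ha (eb ℓ)
  have ha2 := TG_D ha1 (eb j)
  have ha2' := TG_D (TG_D ha (eb j)) (eb ℓ)
  have ha3 := TG_D ha2 (eb ℓ)
  rw [ibp ha1 (inner_dec hγ ℓ j) volume t (eb j)]
  have e : ∀ x, Dv (eb j) (Dv (eb ℓ) a) x • (Dv (eb ℓ) (Dv (eb j) (rho γ 1 t))
      - (2 : ℂ) • (mix γ ℓ j t + mix γ j ℓ t)) x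
      = Dv (eb j) (Dv (eb ℓ) a) x • Dv (eb ℓ) (Dv (eb j) (rho γ 1 t)) x
        - (2 * (Dv (eb j) (Dv (eb ℓ) a) x • mix γ ℓ j t x)
        + 2 * (Dv (eb ℓ) (Dv (eb j) a) x • mix γ j ℓ t x)) := by
    intro x
    rw [Dv_comm ha.1 (eb ℓ) (eb j)]
    simp only [Pi.sub_apply, Pi.smul_apply, Pi.add_apply, smul_eq_mul, Complex.real_smul]
    ring
  have i1 := TG_integrable ha2 ((hr.D (eb j)).D (eb ℓ)) volume t
  have i2 := (TG_integrable ha2 (mix_dec hγ ℓ j) volume t).const_mul 2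
  have i3 := (TG_integrable ha2' (mix_dec hγ j ℓ) volume t).const_mul 2
  have i23 : Integrable (fun x => 2 * (Dv (eb j) (Dv (eb ℓ) a) x • mix γ ℓ j t x)
        + 2 * (Dv (eb ℓ) (Dv (eb j) a) x • mix γ j ℓ t x)) := i2.add i3
  simp only [e]
  rw [integral_sub i1 i23, integral_add i2 i3, integral_const_mul, integral_const_mul,
    ibp ha2 (hr.D (eb j)) volume t (eb ℓ), ibp ha3 hr volume t (eb j)]
  ring

theorem int_Q (hγ : GPSolution d lam γ) {a : Ed d → ℝ} (ha : a.HasTemperateGrowth)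
    (ℓ : Fin d) (t : ℝ) :
    ∫ x, Dv (eb ℓ) a x • Qd lam γ ℓ t x
    = ∑ j, (-(1 / 2) * (∫ x, Dv (eb j) (Dv (eb ℓ) (Dv (eb j) (Dv (eb ℓ) a))) x • rho γ 1 t x)
      + (∫ x, Dv (eb j) (Dv (eb ℓ) a) x • mix γ ℓ j t x)
      + (∫ x, Dv (eb ℓ) (Dv (eb j) a) x • mix γ j ℓ t x))
      + (lam / 2) * ∫ x, Dv (eb ℓ) (Dv (eb ℓ) a) x • rho γ 2 t x := by
  have hr : Dec (rho γ 2) := rho_dec hγ 1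
  have ha1 := TG_D ha (eb ℓ)
  have e : ∀ x, Dv (eb ℓ) a x • Qd lam γ ℓ t x
      = (1 / 2) * (∑ j, Dv (eb ℓ) a x • Dv (eb j) (Dv (eb ℓ) (Dv (eb j) (rho γ 1 t))
      - (2 : ℂ) • (mix γ ℓ j t + mix γ j ℓ t)) x)
        - (lam / 2) * (Dv (eb ℓ) a x • Dv (eb ℓ) (rho γ 2 t) x) := by
    intro x
    simp only [Qd, Pi.sub_apply, Pi.smul_apply, Finset.sum_apply, smul_eq_mul, Complex.real_smul,
      ← Finset.mul_sum]
    ring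
  have i1 := fun j => TG_integrable ha1 ((inner_dec hγ ℓ j).D (eb j)) volume t
  have i2 := (TG_integrable ha1 (hr.D (eb ℓ)) volume t).const_mul ((lam : ℂ) / 2)
  simp only [e]
  rw [integral_sub ((integrable_finsetSum _ fun j _ => i1 j).const_mul _) i2,
    integral_const_mul, integral_const_mul, integral_finsetSum _ fun j _ => i1 j,
    ibp ha1 hr volume t (eb ℓ)]
  simp only [int_inner hγ ha, Finset.mul_sum]
  rw [mul_neg, sub_neg_eq_add]
  congr 1
  refine Finset.sum_congr rfl fun j _ => ?_
  ring

theorem re_int {μ : Measure (Ed d)} {φ : Ed d → ℝ} {f : Ed d → ℂ}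
    (h : Integrable (fun x => φ x • f x) μ) :
    ∫ x, φ x * (f x).re ∂μ = (∫ x, φ x • f x ∂μ).re := by
  have := integral_re h
  simpa using this

theorem rlap_TG {a : Ed d → ℝ} (ha : a.HasTemperateGrowth) : (rlapE a).HasTemperateGrowth :=
  Function.HasTemperateGrowth.sum fun j _ => TG_D (TG_D ha (eb j)) (eb j)

theorem rlap_eq (a : Ed d → ℝ) : rlapE a = ∑ j, Dv (eb j) (Dv (eb j) a) := by
  funext x; simp [rlapE, rpdE_eq]

theorem bilap_eq {a : Ed d → ℝ} (ha : ContDiff ℝ ∞ a) (x : Ed d) :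
    rlapE (rlapE a) x = ∑ ℓ, ∑ j, Dv (eb j) (Dv (eb ℓ) (Dv (eb j) (Dv (eb ℓ) a))) x := by
  have h2 : ∀ ℓ : Fin d, ContDiff ℝ ∞ (Dv (eb ℓ) (Dv (eb ℓ) a)) := fun ℓ =>
    Dv_smooth (Dv_smooth ha _) _
  rw [rlap_eq, rlap_eq, Finset.sum_apply, Finset.sum_comm]
  refine Finset.sum_congr rfl fun j _ => ?_
  rw [Dv_sum _ h2, Dv_sum _ fun ℓ => Dv_smooth (h2 ℓ) _, Finset.sum_apply]
  refine Finset.sum_congr rfl fun ℓ _ => ?_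
  rw [Dv_comm (Dv_smooth ha (eb ℓ)) (eb j) (eb ℓ)]

end fin

/-- One-particle Morawetz identity for the cubic GP hierarchy. -/
theorem statement_14 (d : ℕ) (hd : 1 ≤ d) (lam : ℝ)
    (γ : (k : ℕ) → ℝ → (Fin k → Ed d) → (Fin k → Ed d) → ℂ)
    (hγ : GPSolution d lam γ)
    (a : Ed d → ℝ) (ha : ContDiff ℝ (⊤ : ℕ∞) a)
    (hpoly : ∀ k : ℕ, ∃ C : ℝ, ∃ m : ℕ, ∀ x : Ed d,
        ‖iteratedFDeriv ℝ k a x‖ ≤ C * (1 + ‖x‖) ^ m)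
    (t : ℝ) :
    deriv (fun s => ∫ x : Ed d, ∑ ℓ, rpdE ℓ a x * (Pmom (γ 1 s) ℓ x).re) t
      = -(1 / 2) * (∫ x : Ed d, rlapE (rlapE a) x * (γ 1 t (onePt x) (onePt x)).re)
        + (lam / 2) * (∫ x : Ed d, rlapE a x * (γ 2 t ![x, x] ![x, x]).re)
        + 2 * (∫ x : Ed d, ∑ j, ∑ ℓ,
            ((rpdE j (rpdE ℓ a) x : ℝ) : ℂ) *
              fderiv ℝ (fun z' => fderiv ℝ (fun z => γ 1 t (onePt z) (onePt z')) x
                  (EuclideanSpace.single ℓ 1)) x (EuclideanSpace.single j 1)).re := by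
  have hT : a.HasTemperateGrowth := by
    refine ⟨ha, fun n => ?_⟩
    obtain ⟨C, m, h⟩ := hpoly n
    exact ⟨m, C, h⟩
  have h1 : ∀ ℓ : Fin d, (Dv (eb ℓ) a).HasTemperateGrowth := fun ℓ => TG_D hT _
  have h2 : ∀ j ℓ : Fin d, (Dv (eb j) (Dv (eb ℓ) a)).HasTemperateGrowth := fun j ℓ => TG_D (h1 ℓ) _
  have h4 : ∀ j ℓ : Fin d,
      (Dv (eb j) (Dv (eb ℓ) (Dv (eb j) (Dv (eb ℓ) a)))).HasTemperateGrowth :=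
    fun j ℓ => TG_D (TG_D (h2 j ℓ) _) _
  have hr1 : Dec (rho γ 1) := rho_dec hγ 0
  have hr2 : Dec (rho γ 2) := rho_dec hγ 1
  -- the action as the real part of a complex integral
  have hM : (fun s => ∫ x : Ed d, ∑ ℓ, rpdE ℓ a x * (Pmom (γ 1 s) ℓ x).re)
      = fun s => (∑ ℓ, ∫ x, Dv (eb ℓ) a x • Pmom (γ 1 s) ℓ x).re := by
    funext s
    have i1 := fun ℓ => TG_integrable (h1 ℓ) (P_dec hγ ℓ) volume s
    have i2 : ∀ ℓ, Integrable (fun x => rpdE ℓ a x * (Pmom (γ 1 s) ℓ x).re) := by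
      intro ℓ
      have := (i1 ℓ).re
      simpa [rpdE_eq] using this
    rw [integral_finsetSum _ fun ℓ _ => i2 ℓ, Complex.re_sum]
    exact Finset.sum_congr rfl fun ℓ _ => re_int (i1 ℓ)
  have hD : HasDerivAt (fun s => ∑ ℓ, ∫ x, Dv (eb ℓ) a x • Pmom (γ 1 s) ℓ x)
      (∑ ℓ, ∫ x, Dv (eb ℓ) a x • Qd lam γ ℓ t x) t :=
    HasDerivAt.fun_sum fun ℓ _ => deriv_int volume (h1 ℓ) (P_dec hγ ℓ) (Qd_dec hγ ℓ)
      (fun t x => P_deriv hγ ℓ t x) t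
  have hD' : HasDerivAt (fun s => (∑ ℓ, ∫ x, Dv (eb ℓ) a x • Pmom (γ 1 s) ℓ x).re)
      (∑ ℓ, ∫ x, Dv (eb ℓ) a x • Qd lam γ ℓ t x).re t :=
    Complex.reCLM.hasFDerivAt.comp_hasDerivAt t hD
  rw [hM, hD'.deriv]
  -- the three right-hand terms
  have r1 : ∫ x : Ed d, rlapE (rlapE a) x * (γ 1 t (onePt x) (onePt x)).re
      = (∑ ℓ, ∑ j, ∫ x, Dv (eb j) (Dv (eb ℓ) (Dv (eb j) (Dv (eb ℓ) a))) x • rho γ 1 t x).re := by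
    have e := re_int (TG_integrable (rlap_TG (rlap_TG hT)) hr1 volume t)
    refine Eq.trans e ?_
    congr 1
    have i := fun ℓ j => TG_integrable (h4 j ℓ) hr1 volume t
    simp only [bilap_eq hT.1, Finset.sum_smul]
    rw [integral_finsetSum _ fun ℓ _ => integrable_finsetSum _ fun j _ => i ℓ j]
    exact Finset.sum_congr rfl fun ℓ _ => integral_finsetSum _ fun j _ => i ℓ j
  have r2 : ∫ x : Ed d, rlapE a x * (γ 2 t ![x, x] ![x, x]).re
      = (∑ ℓ, ∫ x, Dv (eb ℓ) (Dv (eb ℓ) a) x • rho γ 2 t x).re := by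
    have e := re_int (TG_integrable (rlap_TG hT) hr2 volume t)
    have hx : ∀ x : Ed d, γ 2 t ![x, x] ![x, x] = rho γ 2 t x := by
      intro x
      have : (![x, x] : Fin 2 → Ed d) = fun _ => x := by
        funext i; fin_cases i <;> rfl
      rw [this]; rfl
    simp only [hx]
    rw [e]
    congr 1
    have i := fun ℓ => TG_integrable (h2 ℓ ℓ) hr2 volume t
    simp only [rlap_eq, Finset.sum_apply, Finset.sum_smul]
    rw [integral_finsetSum _ fun ℓ _ => i ℓ]
  have r3 : (∫ x : Ed d, ∑ j, ∑ ℓ,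
            ((rpdE j (rpdE ℓ a) x : ℝ) : ℂ) *
              fderiv ℝ (fun z' => fderiv ℝ (fun z => γ 1 t (onePt z) (onePt z')) x
                  (EuclideanSpace.single ℓ 1)) x (EuclideanSpace.single j 1))
      = ∑ j, ∑ ℓ, ∫ x, Dv (eb j) (Dv (eb ℓ) a) x • mix γ ℓ j t x := by
    have i := fun j ℓ => TG_integrable (h2 j ℓ) (mix_dec hγ ℓ j) volume t
    simp only [mix_eq hγ, rpdE_eq, ← Complex.real_smul]
    rw [integral_finsetSum _ fun j _ => integrable_finsetSum _ fun ℓ _ => i j ℓ]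
    exact Finset.sum_congr rfl fun j _ => integral_finsetSum _ fun ℓ _ => i j ℓ
  rw [r1, r2, r3]
  have hfin : (∑ ℓ, ∫ x, Dv (eb ℓ) a x • Qd lam γ ℓ t x)
      = ((-(1 / 2) : ℝ) : ℂ) * (∑ ℓ, ∑ j,
          ∫ x, Dv (eb j) (Dv (eb ℓ) (Dv (eb j) (Dv (eb ℓ) a))) x • rho γ 1 t x)
        + ((lam / 2 : ℝ) : ℂ) * (∑ ℓ, ∫ x, Dv (eb ℓ) (Dv (eb ℓ) a) x • rho γ 2 t x)
        + ((2 : ℝ) : ℂ) * (∑ j, ∑ ℓ, ∫ x, Dv (eb j) (Dv (eb ℓ) a) x • mix γ ℓ j t x) := by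
    simp only [int_Q hγ hT, Finset.sum_add_distrib, ← Finset.mul_sum]
    rw [Finset.sum_comm (f := fun ℓ j => ∫ x, Dv (eb j) (Dv (eb ℓ) a) x • mix γ ℓ j t x)]
    push_cast
    ring
  rw [hfin]
  simp only [Complex.add_re, Complex.re_ofReal_mul]
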